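/- Let S be a string, let i ≥ 2 be an index at which a new run starts in the Burrows–Wheeler transform of S, let m be the position of the first mismatch of S[π_{i−1}+1..|S|+1] and S[π_i+1..|S|+1] with m ≥ 2, let P = S[π_i+1..π_i+m−1] be the maximal repeat of the associated maximal pair (π_{i−1}+1, π_i+1, m−1), and let p be a prefix of P such that P = p^q for some rational number q ≥ 1. Then for at least one of the two occurrences S[π_{i−1}+1..π_{i−1}+m−1] and S[π_i+1..π_i+m−1], the maximal |p|-periodic extension of that occurrence contains fewer than |p|+1 additional characters. -/

import Mathlib

variable {α : Type*}

/-- Character at 1-based position `i` of `S`; the sentinel `dollar` outside `[1, |S|]`,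
in particular `S[0] = $` and `S[|S|+1] = $`. -/
def chr (dollar : α) (S : List α) (i : ℕ) : α :=
  if h : 1 ≤ i ∧ i ≤ S.length then S.get ⟨i - 1, by omega⟩ else dollar

/-- The substring `S[i..j]` (as a list), using the sentinel convention. -/
def substr (dollar : α) (S : List α) (i j : ℕ) : List α :=
  (List.range (j + 1 - i)).map (fun k => chr dollar S (i + k))

/-- `Δ` is a period of `T`: `Δ ≥ 1` and characters at distance `Δ` coincide. -/
def IsPeriodOf (Δ : ℕ) (T : List α) : Prop :=
  1 ≤ Δ ∧ ∀ (k : ℕ) (h : k + Δ < T.length), T.get ⟨k, by omega⟩ = T.get ⟨k + Δ, h⟩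

/-- The minimal period length of `T`. -/
noncomputable def minPeriod (T : List α) : ℕ := sInf {Δ | IsPeriodOf Δ T}

/-- `T` is a fractional power with exponent ≥ `q`: its minimal period `Δ` satisfies `|T| ≥ q·Δ`. -/
def IsFracPowGe (q : ℕ) (T : List α) : Prop := q * minPeriod T ≤ T.length

/-- `(n, m, l)` is a maximal pair of `S` (`l ≥ 1`, both occurrences inside `S`,
equal as strings, different preceding characters, different succeeding characters). -/
def IsMaximalPair (dollar : α) (S : List α) (n m l : ℕ) : Prop :=
  1 ≤ l ∧ 1 ≤ n ∧ 1 ≤ m ∧ n + l - 1 ≤ S.length ∧ m + l - 1 ≤ S.length ∧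
  (∀ k < l, chr dollar S (n + k) = chr dollar S (m + k)) ∧
  chr dollar S (n - 1) ≠ chr dollar S (m - 1) ∧
  chr dollar S (n + l) ≠ chr dollar S (m + l)

/-- The two maximal pairs `p`, `p'` of `S` are copies of each other: the unordered pairs of
padded occurrence strings `{S[n-1..n+l], S[m-1..m+l]}` coincide. -/
def CopiesMP (dollar : α) (S : List α) (p p' : ℕ × ℕ × ℕ) : Prop :=
  ({substr dollar S (p.1 - 1) (p.1 + p.2.2), substr dollar S (p.2.1 - 1) (p.2.1 + p.2.2)} :
      Set (List α)) =
  ({substr dollar S (p'.1 - 1) (p'.1 + p'.2.2), substr dollar S (p'.2.1 - 1) (p'.2.1 + p'.2.2)} :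
      Set (List α))

/-- `P` occurs at least twice in `T` (occurrences may overlap). -/
def OccursTwiceIn (P T : List α) : Prop :=
  ∃ p₁ p₂ : ℕ, p₁ < p₂ ∧ p₂ + P.length ≤ T.length ∧ P <+: T.drop p₁ ∧ P <+: T.drop p₂

/-- `L` is the (self-referential) LZ77-decomposition of `S`: each factor is either a fresh
single character, or the longest prefix of the remaining suffix occurring at least twice in
the text up to (and including) this factor. -/
def IsLZ77 (S : List α) (L : List (List α)) : Prop :=
  S = L.flatten ∧
  ∀ (i : ℕ) (h : i < L.length),
    L.get ⟨i, h⟩ ≠ [] ∧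
    ((∃ c : α, L.get ⟨i, h⟩ = [c] ∧ c ∉ (L.take i).flatten) ∨
     (OccursTwiceIn (L.get ⟨i, h⟩) ((L.take i).flatten ++ L.get ⟨i, h⟩) ∧
      ∀ F' : List α, F' <+: S.drop ((L.take i).flatten).length →
        OccursTwiceIn F' ((L.take i).flatten ++ F') → F'.length ≤ (L.get ⟨i, h⟩).length))

/-- The cyclic rotation of `S$` by `k`. -/
def rot (dollar : α) (S : List α) (k : ℕ) : List α :=
  (S ++ [dollar]).drop k ++ (S ++ [dollar]).take k

/-- `π` enumerates (1-based, for `i = 1, …, |S|+1`) the cyclic rotations of `S$`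
in lexicographic order; the BWT of `S` is then `i ↦ S[π i]`. -/
def IsBWTPerm [LinearOrder α] (dollar : α) (S : List α) (π : ℕ → ℕ) : Prop :=
  (∀ i, 1 ≤ i → i ≤ S.length + 1 → π i ≤ S.length) ∧
  (∀ i j, 1 ≤ i → i < j → j ≤ S.length + 1 →
    List.Lex (· < ·) (rot dollar S (π i)) (rot dollar S (π j)))

/-- Number of occurrences of `P` in `T`. -/
def occCount [DecidableEq α] (P T : List α) : ℕ :=
  ((Finset.range (T.length + 1)).filter
    (fun p => p + P.length ≤ T.length ∧ P <+: T.drop p)).card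

/-- `P` is a maximal repeat of `S`: nonempty, occurs at least twice, and every one-character
extension occurs strictly fewer times. -/
def IsMaximalRepeat [DecidableEq α] (S P : List α) : Prop :=
  P ≠ [] ∧ 2 ≤ occCount P S ∧
  (∀ c : α, occCount (c :: P) S < occCount P S) ∧
  (∀ c : α, occCount (P ++ [c]) S < occCount P S)

/-- `u` is primitive: not expressible as `v^k` with `k ≥ 2`. -/
def Primitive (u : List α) : Prop :=
  ∀ (v : List α) (k : ℕ), 2 ≤ k → u ≠ (List.replicate k v).flatten

/-- `(l', r')` is the maximal `Δ`-periodic extension of the occurrence `S[l..r]`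
(the padded maximal `Δ`-periodic extension is then `(l'-1, r'+1)`). -/
def IsMaxPerExt (dollar : α) (S : List α) (Δ l r l' r' : ℕ) : Prop :=
  1 ≤ l' ∧ l' ≤ l ∧ l ≤ r ∧ r ≤ r' ∧ r' ≤ S.length ∧ Δ ≤ r + 1 - l ∧
  IsPeriodOf Δ (substr dollar S l' r') ∧
  ¬ IsPeriodOf Δ (substr dollar S (l' - 1) r') ∧
  ¬ IsPeriodOf Δ (substr dollar S l' (r' + 1))

/-- The maximal periodic extension (w.r.t. the minimal period length) of the occurrence
`S[l..r]` adds at most one period length of additional characters. -/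
def ShortExt (dollar : α) (S : List α) (l r : ℕ) : Prop :=
  ∃ l' r', IsMaxPerExt dollar S (minPeriod (substr dollar S l r)) l r l' r' ∧
    (l - l') + (r' - r) ≤ minPeriod (substr dollar S l r)

section

theorem length_substr (dollar : α) (S : List α) (i j : ℕ) :
    (substr dollar S i j).length = j + 1 - i := by
  simp [substr]

theorem IsPeriodOf.chr_eq {dollar : α} {S : List α} {Δ l r : ℕ}
    (h : IsPeriodOf Δ (substr dollar S l r)) {k : ℕ} (hl : l ≤ k) (hr : k + Δ ≤ r) :
    chr dollar S k = chr dollar S (k + Δ) := by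
  have hk := h.2 (k - l) (by rw [length_substr]; omega)
  simp only [substr, List.get_eq_getElem, List.getElem_map, List.getElem_range] at hk
  rwa [show l + (k - l) = k by omega, show l + (k - l + Δ) = k + Δ by omega] at hk

theorem length_rot (dollar : α) (S : List α) (x : ℕ) :
    (rot dollar S x).length = S.length + 1 := by
  simp [rot]
  omega

theorem getElem_rot (dollar : α) (S : List α) {x k : ℕ} (hk : x + k ≤ S.length)
    (h : k < (rot dollar S x).length) :
    (rot dollar S x)[k] = chr dollar S (x + 1 + k) := by
  simp only [rot, chr]
  rw [List.getElem_append_left (by simp; omega), List.getElem_drop]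
  by_cases hx : x + k < S.length
  · rw [List.getElem_append_left hx, dif_pos (by omega)]
    simp only [List.get_eq_getElem]
    congr 1
    omega
  · rw [List.getElem_append_right (by omega), dif_neg (by omega)]
    simp

variable [LinearOrder α]

theorem rot_lt_rot {dollar : α} {S : List α} {x y n : ℕ}
    (hx : x + n ≤ S.length + 1) (hy : y + n ≤ S.length + 1) (hn : 1 ≤ n)
    (heq : ∀ k, 1 ≤ k → k < n → chr dollar S (x + k) = chr dollar S (y + k))
    (hlt : chr dollar S (x + n) < chr dollar S (y + n)) :
    rot dollar S x < rot dollar S y := by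
  rw [List.lt_iff_exists]
  refine Or.inr ⟨n - 1, by rw [length_rot]; omega, by rw [length_rot]; omega, ?_, ?_⟩
  · intro j hj
    rw [getElem_rot _ _ (by omega), getElem_rot _ _ (by omega), add_assoc, add_assoc]
    exact heq (1 + j) (by omega) (by omega)
  · rw [getElem_rot _ _ (by omega), getElem_rot _ _ (by omega), add_assoc, add_assoc,
      Nat.add_sub_cancel' hn]
    exact hlt

/-- Distinct rotations compare as their characters at the position of the first mismatch. -/
theorem rot_lt_rot_iff {dollar : α} {S : List α} {x y n : ℕ}
    (hx : x + n ≤ S.length + 1) (hy : y + n ≤ S.length + 1) (hn : 1 ≤ n)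
    (heq : ∀ k, 1 ≤ k → k < n → chr dollar S (x + k) = chr dollar S (y + k))
    (hne : chr dollar S (x + n) ≠ chr dollar S (y + n)) :
    rot dollar S x < rot dollar S y ↔ chr dollar S (x + n) < chr dollar S (y + n) := by
  refine ⟨fun h => ?_, rot_lt_rot hx hy hn heq⟩
  refine lt_of_le_of_ne (le_of_not_gt fun h' => ?_) hne
  exact lt_asymm h (rot_lt_rot hy hx hn (fun k h1 h2 => (heq k h1 h2).symm) h')

namespace IsBWTPerm
variable {dollar : α} {S : List α} {π : ℕ → ℕ}

theorem rot_lt (hπ : IsBWTPerm dollar S π) {i j : ℕ} (hi : 1 ≤ i) (hij : i < j)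
    (hj : j ≤ S.length + 1) : rot dollar S (π i) < rot dollar S (π j) :=
  hπ.2 i j hi hij hj

theorem exists_eq (hπ : IsBWTPerm dollar S π) {z : ℕ} (hz : z ≤ S.length) :
    ∃ j, 1 ≤ j ∧ j ≤ S.length + 1 ∧ π j = z := by
  have hinj : Set.InjOn π (Finset.Icc 1 (S.length + 1)) := by
    intro a ha b hb hab
    simp only [Finset.coe_Icc, Set.mem_Icc] at ha hb
    rcases lt_trichotomy a b with h | h | h
    · have := hπ.rot_lt ha.1 h hb.2
      rw [hab] at this
      exact absurd this (lt_irrefl _)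
    · exact h
    · have := hπ.rot_lt hb.1 h ha.2
      rw [hab] at this
      exact absurd this (lt_irrefl _)
  have hmaps : Set.MapsTo π (Finset.Icc 1 (S.length + 1)) (Finset.range (S.length + 1)) := by
    intro a ha
    simp only [Finset.coe_Icc, Set.mem_Icc] at ha
    simpa [Nat.lt_succ_iff] using hπ.1 a ha.1 ha.2
  obtain ⟨j, hj, rfl⟩ := Finset.surjOn_of_injOn_of_card_le π hmaps hinj (by simp)
    (by simpa [Nat.lt_succ_iff] using hz : z ∈ (Finset.range (S.length + 1) : Set ℕ))
  simp only [Finset.coe_Icc, Set.mem_Icc] at hj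
  exact ⟨j, hj.1, hj.2, rfl⟩

theorem not_between (hπ : IsBWTPerm dollar S π) {i z : ℕ} (hi : 2 ≤ i)
    (hi' : i ≤ S.length + 1) (hz : z ≤ S.length) (h₁ : rot dollar S (π (i - 1)) < rot dollar S z)
    (h₂ : rot dollar S z < rot dollar S (π i)) : False := by
  obtain ⟨j, hj, hj', rfl⟩ := hπ.exists_eq hz
  rcases lt_trichotomy j i with h | rfl | h
  · rcases (show j ≤ i - 1 by omega).lt_or_eq with h' | rfl
    · exact lt_asymm h₁ (hπ.rot_lt hj h' (by omega))
    · exact lt_irrefl _ h₁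
  · exact lt_irrefl _ h₂
  · exact lt_asymm h₂ (hπ.rot_lt (by omega) h hj')

end IsBWTPerm

/-- If one occurrence of a `Δ`-periodic repeat extends periodically by `Δ` to the left and another
one by `Δ + 1` to the right, then the rotation shifted left by `Δ` lies between the two. -/
theorem rot_between_of_periodic {dollar : α} {S : List α} {z y m Δ : ℕ}
    (hΔ : 1 ≤ Δ) (hΔm : Δ < m) (hx : z + Δ + m ≤ S.length + 1) (hy : y + m + Δ ≤ S.length)
    (heq : ∀ k, 1 ≤ k → k < m → chr dollar S (z + Δ + k) = chr dollar S (y + k))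
    (hne : chr dollar S (z + Δ + m) ≠ chr dollar S (y + m))
    (hleft : ∀ k, 1 ≤ k → k < m → chr dollar S (z + k) = chr dollar S (z + k + Δ))
    (hright : ∀ k, 1 ≤ k → k ≤ m → chr dollar S (y + k) = chr dollar S (y + k + Δ)) :
    (rot dollar S (z + Δ) < rot dollar S y →
      rot dollar S (z + Δ) < rot dollar S z ∧ rot dollar S z < rot dollar S y) ∧
    (rot dollar S y < rot dollar S (z + Δ) →
      rot dollar S y < rot dollar S z ∧ rot dollar S z < rot dollar S (z + Δ)) := by
  have hzx : ∀ k, 1 ≤ k → k < m → chr dollar S (z + Δ + k) = chr dollar S (z + k) := by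
    intro k h1 h2
    rw [hleft k h1 h2, add_right_comm]
  have hshift : ∀ k, Δ < k → k < m + Δ → chr dollar S (z + k) = chr dollar S (y + k) := by
    intro k h1 h2
    have e1 := heq (k - Δ) (by omega) (by omega)
    have e2 := hright (k - Δ) (by omega) (by omega)
    rw [← e1] at e2
    rwa [show z + Δ + (k - Δ) = z + k by omega, show y + (k - Δ) + Δ = y + k by omega] at e2
  have hzm : chr dollar S (z + m) = chr dollar S (y + m) := hshift m hΔm (by omega)
  have hzy : ∀ k, 1 ≤ k → k < m + Δ → chr dollar S (z + k) = chr dollar S (y + k) := by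
    intro k h1 h2
    by_cases h : k < m
    · rw [← hzx k h1 h, heq k h1 h]
    · exact hshift k (by omega) h2
  have ez : chr dollar S (z + (m + Δ)) = chr dollar S (z + Δ + m) := by
    congr 1
    omega
  have ey : chr dollar S (y + (m + Δ)) = chr dollar S (y + m) := by
    rw [← add_assoc]
    exact (hright m (by omega) le_rfl).symm
  constructor
  · intro h
    rw [rot_lt_rot_iff hx (by omega) (by omega) heq hne] at h
    exact ⟨rot_lt_rot hx (by omega) (by omega) hzx (by rwa [hzm]),
      rot_lt_rot (by omega) (by omega) (by omega) hzy (by rwa [ez, ey])⟩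
  · intro h
    rw [rot_lt_rot_iff (by omega) hx (by omega) (fun k h1 h2 => (heq k h1 h2).symm) hne.symm] at h
    exact ⟨rot_lt_rot (by omega) (by omega) (by omega) (fun k h1 h2 => (hzy k h1 h2).symm)
        (by rwa [ez, ey]),
      rot_lt_rot (by omega) hx (by omega) (fun k h1 h2 => (hzx k h1 h2).symm) (by rwa [hzm])⟩

end

/-- Lemma `non-extendability`. Let a new run start at index `i ≥ 2` of the
Burrows–Wheeler transform of `S`, let `m ≥ 2` be the first mismatch of the suffixes starting
at `π_{i-1}+1` and `π_i+1`, let `P = S[π_i+1..π_i+m-1]` be the maximal repeat of the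
associated maximal pair, and let `p` be a prefix of `P` with `P = p^q` for a rational `q ≥ 1`
(i.e. `P` is `|p|`-periodic). Then the maximal `|p|`-periodic extension of at least one of the
two occurrences `S[π_{i-1}+1..π_{i-1}+m-1]`, `S[π_i+1..π_i+m-1]` contains fewer than `|p|+1`
additional characters. -/
theorem run_boundary_non_extendability [LinearOrder α] (dollar : α) (S : List α)
    (hdollar : dollar ∉ S)
    (π : ℕ → ℕ) (hπ : IsBWTPerm dollar S π)
    (i : ℕ) (hi : 2 ≤ i ∧ i ≤ S.length + 1)
    (hrun : chr dollar S (π (i - 1)) ≠ chr dollar S (π i))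
    (m : ℕ) (hm : 2 ≤ m)
    (hfirst : ∀ k, 1 ≤ k → k < m → chr dollar S (π (i - 1) + k) = chr dollar S (π i + k))
    (hmis : chr dollar S (π (i - 1) + m) ≠ chr dollar S (π i + m))
    (p : List α)
    (hpre : p <+: substr dollar S (π i + 1) (π i + m - 1))
    (hper : IsPeriodOf p.length (substr dollar S (π i + 1) (π i + m - 1))) :
    ∀ l₁ r₁ l₂ r₂ : ℕ,
      IsMaxPerExt dollar S p.length (π (i - 1) + 1) (π (i - 1) + m - 1) l₁ r₁ →
      IsMaxPerExt dollar S p.length (π i + 1) (π i + m - 1) l₂ r₂ →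
      ((π (i - 1) + 1 - l₁) + (r₁ - (π (i - 1) + m - 1)) < p.length + 1 ∨
       (π i + 1 - l₂) + (r₂ - (π i + m - 1)) < p.length + 1) := by
  intro l₁ r₁ l₂ r₂ ⟨h1, h2, h3, h4, h5, h6, hper₁, _, _⟩ ⟨g1, g2, g3, g4, g5, g6, hper₂, _, _⟩
  have hΔ : 1 ≤ p.length := hper.1
  have hleft : l₁ = π (i - 1) + 1 ∨ l₂ = π i + 1 := by
    by_contra! h
    apply hrun
    rw [hper₁.chr_eq (k := π (i - 1)) (by omega) (by omega),
      hper₂.chr_eq (k := π i) (by omega) (by omega)]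
    exact hfirst _ hΔ (by omega)
  have hright : r₁ = π (i - 1) + m - 1 ∨ r₂ = π i + m - 1 := by
    by_contra! h
    apply hmis
    have e₁ := hper₁.chr_eq (k := π (i - 1) + (m - p.length)) (by omega) (by omega)
    have e₂ := hper₂.chr_eq (k := π i + (m - p.length)) (by omega) (by omega)
    rw [hfirst _ (by omega) (by omega), e₂] at e₁
    rw [show π (i - 1) + m = π (i - 1) + (m - p.length) + p.length by omega,
      show π i + m = π i + (m - p.length) + p.length by omega, e₁]
  have hlt := hπ.rot_lt (i := i - 1) (j := i) (by omega) (by omega) hi.2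
  by_contra! hlong
  rcases hleft with hl | hl
  · obtain ⟨z, hz⟩ : ∃ z, π i = z + p.length := ⟨π i - p.length, by omega⟩
    have hb := (rot_between_of_periodic (dollar := dollar) (S := S) (z := z) (y := π (i - 1))
      (m := m) (Δ := p.length) hΔ (by omega) (by omega) (by omega)
      (fun k a b => by rw [← hz]; exact (hfirst k a b).symm) (by rw [← hz]; exact hmis.symm)
      (fun k _ _ => hper₂.chr_eq (by omega) (by omega))
      (fun k _ _ => hper₁.chr_eq (by omega) (by omega))).2 (by rwa [← hz])
    rw [← hz] at hb
    exact hπ.not_between hi.1 hi.2 (by omega) hb.1 hb.2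
  · obtain ⟨z, hz⟩ : ∃ z, π (i - 1) = z + p.length := ⟨π (i - 1) - p.length, by omega⟩
    have hb := (rot_between_of_periodic (dollar := dollar) (S := S) (z := z) (y := π i)
      (m := m) (Δ := p.length) hΔ (by omega) (by omega) (by omega)
      (fun k a b => by rw [← hz]; exact hfirst k a b) (by rw [← hz]; exact hmis)
      (fun k _ _ => hper₁.chr_eq (by omega) (by omega))
      (fun k _ _ => hper₂.chr_eq (by omega) (by omega))).1 (by rwa [← hz])
    rw [← hz] at hb
    exact hπ.not_between hi.1 hi.2 (by omega) hb.1 hb.2
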